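/- Let g be a finite-dimensional real Lie algebra, let k and k' be Lie subalgebras of g, and let p and p' be linear subspaces with g = k ⊕ p and g = k' ⊕ p'. Suppose there is a linear isomorphism ν : g → g such that ν(k) = k', the restriction ν|_k : k → k' is an isomorphism of Lie algebras, and ν([X,Y]) − [ν(X), ν(Y)] ∈ k' for all X ∈ k and Y ∈ g. Then the Lie algebras (g, [·,·]₀^{k,p}) and (g, [·,·]₀^{k',p'}) are isomorphic. -/

import Mathlib

open Submodule

variable {g : Type*} [LieRing g] [LieAlgebra ℝ g]

/-- The contracted (Inönü–Wigner) bracket `[·,·]₀^{k,p}` associated to a decomposition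
`g = k ⊕ p`. -/
noncomputable def contractedBracket (k p : Submodule ℝ g) (h : IsCompl k p)
    (X Y : g) : g :=
  let prK : g →ₗ[ℝ] g := k.subtype ∘ₗ (Submodule.linearProjOfIsCompl k p h)
  let prP : g →ₗ[ℝ] g := p.subtype ∘ₗ (Submodule.linearProjOfIsCompl p k h.symm)
  ⁅prK X, prK Y⁆ + prP ⁅prK X, prP Y⁆ + prP ⁅prP X, prK Y⁆

/-- The contracted bracket expressed through the pair of complementary projections. -/
lemma exists_projections_contractedBracket (k p : Submodule ℝ g) (h : IsCompl k p) :
    ∃ prK prP : g →ₗ[ℝ] g,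
      (∀ X, prK X ∈ k) ∧ (∀ X, prP X ∈ p) ∧ (∀ X, prK X + prP X = X) ∧
      (∀ X ∈ k, prK X = X) ∧ (∀ X ∈ p, prK X = 0) ∧
      (∀ X ∈ p, prP X = X) ∧ (∀ X ∈ k, prP X = 0) ∧
      ∀ X Y, contractedBracket k p h X Y =
        ⁅prK X, prK Y⁆ + prP ⁅prK X, prP Y⁆ + prP ⁅prP X, prK Y⁆ := by
  refine ⟨k.subtype ∘ₗ Submodule.projectionOnto k p h,
    p.subtype ∘ₗ Submodule.projectionOnto p k h.symm, fun X => Subtype.coe_prop _,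
    fun X => Subtype.coe_prop _, fun X => ?_, fun X hX => ?_, fun X hX => ?_, fun X hX => ?_,
    fun X hX => ?_, fun X Y => rfl⟩
  · exact Submodule.projection_add_projection_eq_self h X
  · exact congrArg Subtype.val (Submodule.projectionOnto_apply_left h ⟨X, hX⟩)
  · exact congrArg Subtype.val (Submodule.projectionOnto_apply_right h ⟨X, hX⟩)
  · exact congrArg Subtype.val (Submodule.projectionOnto_apply_left h.symm ⟨X, hX⟩)
  · exact congrArg Subtype.val (Submodule.projectionOnto_apply_right h.symm ⟨X, hX⟩)

/-- Let `g` be a finite-dimensional real Lie algebra, `k, k'` Lie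
subalgebras, `p, p'` complements.  If there is a linear automorphism `ν` of `g` with
`ν(k) = k'`, restricting to a Lie algebra isomorphism `k → k'`, and with
`ν[X,Y] − [νX, νY] ∈ k'` for all `X ∈ k`, `Y ∈ g`, then `(g, [·,·]₀^{k,p})` and
`(g, [·,·]₀^{k',p'})` are isomorphic Lie algebras. -/
theorem equivalent_subalgebras_give_isomorphic_contractions
    (g : Type*) [LieRing g] [LieAlgebra ℝ g] [FiniteDimensional ℝ g]
    (k k' : LieSubalgebra ℝ g) (p p' : Submodule ℝ g)
    (h : IsCompl k.toSubmodule p) (h' : IsCompl k'.toSubmodule p')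
    (ν : g ≃ₗ[ℝ] g)
    (hmap : k.toSubmodule.map (ν : g →ₗ[ℝ] g) = k'.toSubmodule)
    (hrestr : ∀ X ∈ k, ∀ Y ∈ k, ν ⁅X, Y⁆ = ⁅ν X, ν Y⁆)
    (hmixed : ∀ X ∈ k, ∀ Y : g, ν ⁅X, Y⁆ - ⁅ν X, ν Y⁆ ∈ k') :
    ∃ e : g ≃ₗ[ℝ] g, ∀ X Y : g,
      e (contractedBracket k.toSubmodule p h X Y)
        = contractedBracket k'.toSubmodule p' h' (e X) (e Y) := by
  obtain ⟨prK, prP, memK, memP, add_eq, prK_k, prK_p, prP_p, prP_k, hbr⟩ :=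
    exists_projections_contractedBracket k.toSubmodule p h
  obtain ⟨prK', prP', memK', memP', add_eq', prK'_k, prK'_p, prP'_p, prP'_k, hbr'⟩ :=
    exists_projections_contractedBracket k'.toSubmodule p' h'
  have ν_mem : ∀ X ∈ k, ν X ∈ k' := fun X hX =>
    (hmap ▸ Submodule.mem_map_of_mem hX : ν X ∈ k'.toSubmodule)
  have mem_of_ν_mem : ∀ X, ν X ∈ k' → X ∈ k := by
    intro X hX
    have hX' : ν X ∈ k.toSubmodule.map (ν : g →ₗ[ℝ] g) := hmap.symm ▸ hX
    obtain ⟨Y, hY, hYX⟩ := hX'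
    exact ν.injective hYX ▸ hY
  let f : g →ₗ[ℝ] g := (ν : g →ₗ[ℝ] g) ∘ₗ prK + prP' ∘ₗ (ν : g →ₗ[ℝ] g)
  have f_apply : ∀ X, f X = ν (prK X) + prP' (ν X) := fun X => rfl
  have prK'_f : ∀ X, prK' (f X) = ν (prK X) := fun X => by
    rw [f_apply, map_add, prK'_k _ (ν_mem _ (memK X)), prK'_p _ (memP' _), add_zero]
  have prP'_f : ∀ X, prP' (f X) = prP' (ν X) := fun X => by
    rw [f_apply, map_add, prP'_k _ (ν_mem _ (memK X)), prP'_p _ (memP' _), zero_add]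
  have f_inj : Function.Injective f := by
    rw [injective_iff_map_eq_zero]
    intro X hX
    have hK : prK X = 0 := by
      have := prK'_f X
      rw [hX, map_zero] at this
      exact (map_eq_zero_iff ν ν.injective).1 this.symm
    have hP : prP' (ν X) = 0 := by rw [← prP'_f, hX, map_zero]
    have hk : ν X ∈ k' := by
      rw [← add_eq' (ν X), hP, add_zero]
      exact memK' _
    rw [← prK_k X (mem_of_ν_mem X hk), hK]
  have congr_k' : ∀ X Y, X - Y ∈ k' → prP' X = prP' Y := fun X Y hXY => by
    rw [← sub_eq_zero, ← map_sub, prP'_k _ hXY]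
  have prP'_ν_prP : ∀ X, prP' (ν (prP X)) = prP' (ν X) := fun X => by
    conv_rhs => rw [← add_eq X, map_add, map_add, prP'_k _ (ν_mem _ (memK X)), zero_add]
  have prP'_ν_lie : ∀ a ∈ k, ∀ Y,
      prP' (ν (prP ⁅a, prP Y⁆)) = prP' ⁅ν a, prP' (ν Y)⁆ := by
    intro a ha Y
    rw [prP'_ν_prP, congr_k' _ _ (hmixed a ha (prP Y)), ← prP'_ν_prP Y]
    apply congr_k'
    rw [← lie_sub]
    refine k'.lie_mem (ν_mem a ha) ?_
    rw [sub_eq_of_eq_add (add_eq' (ν (prP Y))).symm]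
    exact memK' _
  refine ⟨LinearEquiv.ofInjectiveEndo f f_inj, fun X Y => ?_⟩
  simp only [LinearEquiv.coe_ofInjectiveEndo]
  have hk : ⁅prK X, prK Y⁆ ∈ k := k.lie_mem (memK X) (memK Y)
  rw [hbr, hbr', prK'_f, prK'_f, prP'_f, prP'_f, ← hrestr _ (memK X) _ (memK Y),
    ← lie_skew (prP X), ← lie_skew (prP' (ν X)), map_neg, map_neg, ← prP'_ν_lie _ (memK X),
    ← prP'_ν_lie _ (memK Y), f_apply]
  simp only [map_add, map_neg, prK_k _ hk, prK_p _ (memP _), prP'_k _ (ν_mem _ hk), map_zero]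
  abel
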